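/- Let x, z ∈ P with x ≥ z, and let φ : *E_x → *E_z be a degree-preserving S-homomorphism with φ(1_x) ≠ 0. Then there exists a Z^n-graded S-module automorphism σ of *E_x such that φ ∘ σ is a clean map. -/

import Mathlib

open scoped Classical
open MvPolynomial

noncomputable section

variable (K : Type) [Field K]
variable (P : Type) [Fintype P] [PartialOrder P] [OrderBot P]

/-- A finite poset with a least element is *simplicial* if every lower interval
is isomorphic to a boolean algebra (the lattice of all subsets of a finite set). -/
def IsSimplicialPoset : Prop :=
  ∀ x : P, ∃ m : ℕ, Nonempty (Set.Iic x ≃o Finset (Fin m))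

/-- `P* := P \ {0̂}`. -/
abbrev Pstar := {z : P // z ≠ ⊥}

/-- The polynomial ring `S = K[t_z : z ∈ P*]`. -/
abbrev FaceS := MvPolynomial (Pstar P) K

/-- The variable `t_z`, with the convention `t_{0̂} = 1`. -/
def tvar (z : P) : FaceS K P := if h : z = ⊥ then 1 else X ⟨z, h⟩

/-- The set `[a ∨ b]` of minimal elements of the common upper bounds of `a` and `b`. -/
def minUB (a b : P) : Set P :=
  {z | a ≤ z ∧ b ≤ z ∧ ∀ w, a ≤ w → b ≤ w → ¬ w < z}

/-- Minimal elements of the common upper bounds of a set `A`. -/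
def minUBset (A : Set P) : Set P :=
  {z | (∀ a ∈ A, a ≤ z) ∧ ∀ w, (∀ a ∈ A, a ≤ w) → ¬ w < z}

/-- The meet `a ∧ b`, i.e. the largest common lower bound, when it exists (`⊥` otherwise). -/
def pmeet (a b : P) : P :=
  if h : ∃ m, m ≤ a ∧ m ≤ b ∧ ∀ w, w ≤ a → w ≤ b → w ≤ m then h.choose else ⊥

/-- The generator `f_{a,b} = t_a t_b - t_{a ∧ b} ∑_{z ∈ [a ∨ b]} t_z` of the face ideal. -/
def fgen (a b : Pstar P) : FaceS K P :=
  X a * X b - tvar K P (pmeet P a.1 b.1) *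
    ∑ z ∈ (Set.toFinite (minUB P a.1 b.1)).toFinset, tvar K P z

/-- The face ideal `I_P`. -/
def faceIdeal : Ideal (FaceS K P) :=
  Ideal.span (Set.range fun p : Pstar P × Pstar P => fgen K P p.1 p.2)

variable (n : ℕ) (y : Fin n → P)

/-- `y` is an enumeration of the rank one elements (= atoms) of `P`. -/
def AtomEnum : Prop :=
  Function.Injective y ∧ ∀ p : P, IsAtom p ↔ ∃ i, y i = p

/-- The rank of an element: the number of atoms below it. -/
def prank (z : P) : ℕ := (Finset.univ.filter fun i : Fin n => y i ≤ z).card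

/-- The `ℤⁿ`-degree of the variable `t_z`: `deg t_z = ∑_{y_i ≤ z} e_i`. -/
def tdeg (z : Pstar P) : Fin n → ℤ := fun i => if y i ≤ z.1 then 1 else 0

/-- `w = ∑_{z ∈ P*} deg t_z`. -/
def wvec : Fin n → ℤ := fun i => ∑ z : Pstar P, tdeg P n y z i

/-- The degree `d` homogeneous component of `S` for the `ℤⁿ`-grading. -/
def Sgrade (d : Fin n → ℤ) : AddSubgroup (FaceS K P) :=
  (weightedHomogeneousSubmodule K (tdeg P n y) d).toAddSubgroup

/-- The transformed variable `t̃_z` (relative to `x`), with `t̃_{0̂} = 1`. -/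
def ttil (x z : P) : FaceS K P :=
  if z ≤ x ∧ 2 ≤ prank P n y z then
    tvar K P z - ∏ i ∈ Finset.univ.filter fun i : Fin n => y i ≤ z, tvar K P (y i)
  else tvar K P z

/-- The graded prime ideal `p_x = (t_z : z ≰ x) + I_P`. -/
def pIdeal (x : P) : Ideal (FaceS K P) :=
  Ideal.span ((fun z : Pstar P => (X z : FaceS K P)) '' {z | ¬ z.1 ≤ x}) ⊔ faceIdeal K P

/-- The indices of the atoms below `x`. -/
abbrev BelowIx (x : P) := {i : Fin n // y i ≤ x}

/-- `P*_{-x}`: the elements of `P*` which are not atoms below `x`. -/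
abbrev Pmx (x : P) := {z : P // z ≠ ⊥ ∧ ¬ ∃ i : Fin n, y i ≤ x ∧ y i = z}

/-- Index monoid for the "big Laurent" model of `*E_x`. -/
abbrev EIdx (x : P) := (BelowIx P n y x →₀ ℤ) × (Pmx P n y x →₀ ℤ)

/-- The "big Laurent" algebra `K[t_i^{±1} : y_i ≤ x] ⊗_K K[t̃_z^{±1} : z ∈ P*_{-x}]`. -/
abbrev Gx (x : P) := AddMonoidAlgebra K (EIdx P n y x)

/-- Exponent vector of `π_x(t_z) = ∏_{y_i ≤ z} t_i`. -/
def dvec (x : P) (z : P) : BelowIx P n y x →₀ ℤ :=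
  Finsupp.equivFunOnFinite.symm fun i => if y i.1 ≤ z then 1 else 0

/-- The action of `S` on the big Laurent algebra through the comultiplication
`Δ(t_z) = t_z ⊗ 1 + 1 ⊗ t_z`:  the variable `t_z` acts as `π_x(t_z) ⊗ 1 + 1 ⊗ t_z`. -/
def theta (x : P) : FaceS K P →ₐ[K] Gx K P n y x :=
  aeval fun z : Pstar P =>
    (if z.1 ≤ x then AddMonoidAlgebra.single (dvec P n y x z.1, 0) 1 else 0) +
    (if h : ∃ i : Fin n, y i ≤ x ∧ y i = z.1 then 0
     else AddMonoidAlgebra.single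
       ((0 : BelowIx P n y x →₀ ℤ), Finsupp.single (⟨z.1, z.2, h⟩ : Pmx P n y x) (1 : ℤ)) 1)

instance gxModule (x : P) : Module (FaceS K P) (Gx K P n y x) :=
  Module.compHom _ (theta K P n y x).toRingHom

instance gxTower (x : P) : IsScalarTower K (FaceS K P) (Gx K P n y x) := by
  refine ⟨fun k s g => ?_⟩
  show theta K P n y x (k • s) * g = k • (theta K P n y x s * g)
  rw [map_smul, smul_mul_assoc]

instance gxComm (x : P) : SMulCommClass (FaceS K P) K (Gx K P n y x) := by
  refine ⟨fun s k g => ?_⟩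
  show theta K P n y x s * (k • g) = k • (theta K P n y x s * g)
  exact mul_smul_comm k _ g

/-- The submodule by which we quotient the big Laurent algebra to obtain `*E_x`. -/
def Ux (x : P) : Submodule (FaceS K P) (Gx K P n y x) :=
  Submodule.span (FaceS K P)
    {g | ∃ p : EIdx P n y x, (∃ w, 0 < p.2 w) ∧ g = AddMonoidAlgebra.single p 1}

/-- The `ℤⁿ`-graded `S`-module `*E_x = K[t_i^{±1} : y_i ≤ x] ⊗_K K[t_z^{-1} : z ∈ P*_{-x}]`. -/
abbrev ExMod (x : P) := Gx K P n y x ⧸ Ux K P n y x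

instance exComm (x : P) : SMulCommClass (FaceS K P) K (ExMod K P n y x) := by
  refine ⟨fun s k e => ?_⟩
  obtain ⟨g, rfl⟩ := Submodule.Quotient.mk_surjective _ e
  simp only [← Submodule.Quotient.mk_smul]
  rw [smul_comm]

def mIdx (x : P) (a : BelowIx P n y x →₀ ℤ) (b : Pmx P n y x →₀ ℕ) : EIdx P n y x :=
  (a, -Finsupp.mapRange (Nat.cast : ℕ → ℤ) Nat.cast_zero b)

/-- The monomial `∏ t_i^{a_i} ⊗ ∏ t_z^{-b_z}` of `*E_x`. -/
def emono (x : P) (a : BelowIx P n y x →₀ ℤ) (b : Pmx P n y x →₀ ℕ) : ExMod K P n y x :=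
  Submodule.Quotient.mk (AddMonoidAlgebra.single (mIdx P n y x a b) 1)

/-- `1_x = 1 ⊗ 1 ∈ *E_x`. -/
def onex (x : P) : ExMod K P n y x := emono K P n y x 0 0

/-- The `ℤⁿ`-degree of the monomial of `*E_x` with index `p`. -/
def gdeg (x : P) (p : EIdx P n y x) : Fin n → ℤ := fun i =>
  (if h : y i ≤ x then p.1 ⟨i, h⟩ else 0) +
    p.2.sum fun w c => c * (if y i ≤ w.1 then 1 else 0)

/-- The degree `aa` homogeneous component of `*E_x`. -/
def ExGrade (x : P) (aa : Fin n → ℤ) : Submodule K (ExMod K P n y x) :=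
  Submodule.span K
    {e | ∃ p : EIdx P n y x, gdeg P n y x p = aa ∧
      e = Submodule.Quotient.mk (AddMonoidAlgebra.single p 1)}

/-- `L(*E_x)`: the span of the basis monomials with nontrivial second factor and
componentwise nonnegative `ℤⁿ`-degree. -/
def cleanL (x : P) : Submodule K (ExMod K P n y x) :=
  Submodule.span K
    {e | ∃ a b, b ≠ 0 ∧ (∀ i, 0 ≤ gdeg P n y x (mIdx P n y x a b) i) ∧
      e = emono K P n y x a b}

/-- Degree preserving homomorphisms `*E_x → *E_z` (elements of `[*Hom(E_x, E_z)]_0`). -/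
def DegZero (x z : P) (φ : ExMod K P n y x →ₗ[FaceS K P] ExMod K P n y z) : Prop :=
  ∀ aa, ∀ e ∈ ExGrade K P n y x aa, φ e ∈ ExGrade K P n y z aa

/-- Clean homomorphisms `*E_x → *E_z`. -/
def IsClean (x z : P) (φ : ExMod K P n y x →ₗ[FaceS K P] ExMod K P n y z) : Prop :=
  DegZero K P n y x z φ ∧ ∀ e ∈ cleanL K P n y x, φ e ∈ cleanL K P n y z

set_option linter.unusedSectionVars false

section Series

variable {S M k ι : Type*} [CommRing S] [AddCommGroup M] [Module S M] [Field k] [Module k M]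
  [Algebra k S] [IsScalarTower k S M]

omit [Algebra k S] [IsScalarTower k S M] in
lemma hasFiniteSupport_smul {U : (ι →₀ ℕ) → M →ₗ[S] M} {e : M} (hfin : {c | U c e ≠ 0}.Finite)
    (lam : (ι →₀ ℕ) → k) : Function.HasFiniteSupport fun c => lam c • U c e :=
  hfin.subset fun c hc h0 => hc (by simp [h0])

/-- The operator `e ↦ ∑ᶠ c, lam c • U c e` of a locally finite family of operators. -/
def seriesEnd (U : (ι →₀ ℕ) → M →ₗ[S] M) (hfin : ∀ e, {c | U c e ≠ 0}.Finite)
    (lam : (ι →₀ ℕ) → k) : M →ₗ[S] M where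
  toFun e := ∑ᶠ c, lam c • U c e
  map_add' e f := by
    simp only [map_add, smul_add]
    exact finsum_add_distrib (hasFiniteSupport_smul (hfin e) lam)
      (hasFiniteSupport_smul (hfin f) lam)
  map_smul' s e := by
    simp only [map_smul, RingHom.id_apply]
    rw [smul_finsum' s (hasFiniteSupport_smul (hfin e) lam)]
    simp only [smul_comm s]

variable {U : (ι →₀ ℕ) → M →ₗ[S] M} (hfin : ∀ e, {c | U c e ≠ 0}.Finite) {lam : (ι →₀ ℕ) → k}

lemma seriesEnd_apply (e : M) : seriesEnd U hfin lam e = ∑ᶠ c, lam c • U c e := rfl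

lemma seriesEnd_mem {N : Submodule k M} (hN : ∀ c, ∀ e ∈ N, U c e ∈ N) {e : M} (he : e ∈ N) :
    seriesEnd U hfin lam e ∈ N :=
  finsum_induction (· ∈ N) N.zero_mem (fun _ _ => N.add_mem)
    fun c => N.smul_mem _ (hN c e he)

variable (h_zero : ∀ e, U 0 e = e) (h_add : ∀ c c' e, U (c + c') e = U c (U c' e))

include h_zero h_add

lemma apply_seriesEnd (h0 : lam 0 = 1) {m : ℕ} {e : M}
    (he : ∀ c : ι →₀ ℕ, m + 1 ≤ c.degree → U c e = 0) (c : ι →₀ ℕ) (hc : m ≤ c.degree) :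
    U c (seriesEnd U hfin lam e) = U c e := by
  rw [seriesEnd_apply, map_finsum _ (hasFiniteSupport_smul (hfin e) lam), finsum_eq_single _ 0]
  · simp [h0, h_zero]
  · intro c' hc'
    rw [LinearMap.map_smul_of_tower, ← h_add, he, smul_zero]
    have : c'.degree ≠ 0 := fun h => hc' ((Finsupp.degree_eq_zero_iff _).1 h)
    rw [map_add]
    omega

lemma one_sub_seriesEnd_pow (h0 : lam 0 = 1) (m : ℕ) {e : M}
    (he : ∀ c : ι →₀ ℕ, m ≤ c.degree → U c e = 0) :
    ((1 - seriesEnd U hfin lam : Module.End S M) ^ m) e = 0 := by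
  induction m generalizing e with
  | zero => simpa [h_zero] using he 0
  | succ m ih =>
    rw [pow_succ, Module.End.mul_apply]
    refine ih fun c hc => ?_
    rw [LinearMap.sub_apply, Module.End.one_apply, map_sub,
      apply_seriesEnd hfin h_zero h_add h0 he c hc, sub_self]

omit h_zero h_add in
lemma exists_degree_bound {e : M} (he : {c | U c e ≠ 0}.Finite) :
    ∃ m, ∀ c : ι →₀ ℕ, m ≤ c.degree → U c e = 0 := by
  obtain ⟨m, hm⟩ := (he.image Finsupp.degree).bddAbove
  refine ⟨m + 1, fun c hc => ?_⟩
  by_contra h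
  have := hm ⟨c, h, rfl⟩
  omega

/-- A locally finite power series with constant coefficient `1` in commuting operators is
bijective, and its inverse preserves every subspace preserved by the operators. -/
lemma exists_inverse_seriesEnd (h0 : lam 0 = 1) :
    ∃ σ : M ≃ₗ[S] M, (∀ e, σ.symm e = seriesEnd U hfin lam e) ∧
      ∀ N : Submodule k M, (∀ c, ∀ e ∈ N, U c e ∈ N) → ∀ e ∈ N, σ e ∈ N := by
  set τ : Module.End S M := seriesEnd U hfin lam with hτ
  have hpow (e : M) : ∃ m : ℕ, ((1 - τ : Module.End S M) ^ m) e = 0 :=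
    (exists_degree_bound (hfin e)).imp fun m hm =>
      one_sub_seriesEnd_pow hfin h_zero h_add h0 m hm
  have hinv (e : M) : ∃ m, τ ((∑ i ∈ Finset.range m, (1 - τ) ^ i) e) = e := by
    obtain ⟨m, hm⟩ := hpow e
    refine ⟨m, ?_⟩
    have := mul_neg_geom_sum (1 - τ) m
    rw [sub_sub_cancel] at this
    rw [← Module.End.mul_apply, this, LinearMap.sub_apply, hm, sub_zero, Module.End.one_apply]
  have hinj : Function.Injective τ := by
    rw [← LinearMap.ker_eq_bot, LinearMap.ker_eq_bot']
    intro e he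
    obtain ⟨m, hm⟩ := hpow e
    have hfix (m : ℕ) : ((1 - τ : Module.End S M) ^ m) e = e := by
      induction m with
      | zero => simp
      | succ m ih =>
        rw [pow_succ, Module.End.mul_apply, LinearMap.sub_apply, he, sub_zero,
          Module.End.one_apply, ih]
    rw [← hfix m, hm]
  let ρ := LinearEquiv.ofBijective τ ⟨hinj, fun e => (hinv e).elim fun m hm => ⟨_, hm⟩⟩
  refine ⟨ρ.symm, fun e => rfl, fun N hN e he => ?_⟩
  obtain ⟨m, hm⟩ := hinv e
  have : ρ.symm e = (∑ i ∈ Finset.range m, (1 - τ) ^ i) e := by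
    rw [LinearEquiv.symm_apply_eq]
    exact hm.symm
  rw [this, LinearMap.sum_apply]
  refine N.sum_mem fun i hi => ?_
  clear hi
  induction i with
  | zero => simpa using he
  | succ i ih =>
    rw [pow_succ', Module.End.mul_apply, LinearMap.sub_apply, Module.End.one_apply]
    exact N.sub_mem ih (seriesEnd_mem hfin hN ih)

end Series

section Monomials

variable {K P n y}

lemma theta_X (x : P) (v : Pstar P) : theta K P n y x (X v) =
    (if v.1 ≤ x then AddMonoidAlgebra.single (dvec P n y x v.1, 0) 1 else 0) +
    (if h : ∃ i : Fin n, y i ≤ x ∧ y i = v.1 then 0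
     else AddMonoidAlgebra.single
       ((0 : BelowIx P n y x →₀ ℤ), Finsupp.single (⟨v.1, v.2, h⟩ : Pmx P n y x) (1 : ℤ)) 1) := by
  rw [theta, aeval_X]

lemma smul_def (x : P) (s : FaceS K P) (g : Gx K P n y x) : s • g = theta K P n y x s * g := rfl

lemma single_mul_mem_Ux {x : P} {q : EIdx P n y x} (hq : 0 ≤ q.2) {g : Gx K P n y x}
    (hg : g ∈ Ux K P n y x) : AddMonoidAlgebra.single q 1 * g ∈ Ux K P n y x := by
  induction hg using Submodule.span_induction with
  | mem g hg =>
    obtain ⟨p, ⟨w, hw⟩, rfl⟩ := hg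
    rw [AddMonoidAlgebra.single_mul_single, mul_one]
    exact Submodule.subset_span ⟨q + p, ⟨w, add_pos_of_nonneg_of_pos (hq w) hw⟩, rfl⟩
  | zero => simp
  | add g g' _ _ hg hg' => rw [mul_add]; exact add_mem hg hg'
  | smul s g _ hg =>
    rw [smul_def, mul_left_comm, ← smul_def]
    exact Submodule.smul_mem _ _ hg

/-- Multiplication by a monomial whose second factor has nonnegative exponents. -/
def shift {x : P} (q : EIdx P n y x) (hq : 0 ≤ q.2) :
    ExMod K P n y x →ₗ[FaceS K P] ExMod K P n y x :=
  Submodule.mapQ _ _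
    { toFun := fun g : Gx K P n y x => AddMonoidAlgebra.single q 1 * g
      map_add' := mul_add _
      map_smul' := fun s g => mul_left_comm _ (theta K P n y x s) g }
    fun _ hg => single_mul_mem_Ux hq hg

lemma shift_mk {x : P} (q : EIdx P n y x) (hq : 0 ≤ q.2) (g : Gx K P n y x) :
    shift q hq (Submodule.Quotient.mk g) =
      Submodule.Quotient.mk (AddMonoidAlgebra.single q 1 * g) := rfl

variable (K) in
/-- The class in `*E_x` of the Laurent monomial with exponent `p`. -/
def mkMono {x : P} (p : EIdx P n y x) : ExMod K P n y x :=
  Submodule.Quotient.mk (AddMonoidAlgebra.single p 1)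

lemma shift_mkMono {x : P} (q : EIdx P n y x) (hq : 0 ≤ q.2) (p : EIdx P n y x) :
    shift q hq (mkMono K p) = mkMono K (q + p) := by
  rw [mkMono, shift_mk, AddMonoidAlgebra.single_mul_single, mul_one, mkMono]

lemma mkMono_eq_zero {x : P} {p : EIdx P n y x} (hp : ¬ p.2 ≤ 0) : mkMono K p = 0 := by
  obtain ⟨w, hw⟩ : ∃ w, 0 < p.2 w := by
    by_contra! h
    exact hp h
  exact (Submodule.Quotient.mk_eq_zero _).2 (Submodule.subset_span ⟨p, ⟨w, hw⟩, rfl⟩)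

lemma span_mkMono (x : P) : Submodule.span K (Set.range (mkMono K : EIdx P n y x → _)) = ⊤ := by
  rw [eq_top_iff]
  rintro e -
  obtain ⟨g, rfl⟩ := Submodule.Quotient.mk_surjective _ e
  induction g using AddMonoidAlgebra.induction_linear with
  | zero => exact zero_mem _
  | add g g' hg hg' => exact add_mem hg hg'
  | single p r =>
    have : (Submodule.Quotient.mk (AddMonoidAlgebra.single p r) : ExMod K P n y x) =
        r • mkMono K p := by
      rw [mkMono, ← Submodule.Quotient.mk_smul, AddMonoidAlgebra.smul_single, smul_eq_mul, mul_one]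
    rw [this]
    exact Submodule.smul_mem _ _ (Submodule.subset_span ⟨p, rfl⟩)

lemma smul_eq_shift {x : P} {s : FaceS K P} {q : EIdx P n y x} (hq : 0 ≤ q.2)
    (hs : theta K P n y x s = AddMonoidAlgebra.single q 1) (e : ExMod K P n y x) :
    s • e = shift q hq e := by
  obtain ⟨g, rfl⟩ := Submodule.Quotient.mk_surjective _ e
  rw [shift_mk, ← hs, ← Submodule.Quotient.mk_smul, smul_def]

lemma coeff_theta_mul {x : P} (s : FaceS K P) {g : Gx K P n y x}
    (hg : ∀ p : EIdx P n y x, p.2 ≤ 0 → g.coeff p = 0) :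
    ∀ p : EIdx P n y x, p.2 ≤ 0 → (theta K P n y x s * g).coeff p = 0 := by
  have key (q : EIdx P n y x) (hq : 0 ≤ q.2) {g : Gx K P n y x}
      (hg : ∀ p : EIdx P n y x, p.2 ≤ 0 → g.coeff p = 0) (p : EIdx P n y x) (hp : p.2 ≤ 0) :
      (AddMonoidAlgebra.single q (1 : K) * g).coeff p = 0 := by
    rw [AddMonoidAlgebra.coeff_single_mul_apply, hg, mul_zero]
    exact add_nonpos (neg_nonpos.2 hq) hp
  induction s using MvPolynomial.induction_on generalizing g with
  | C a =>
    intro p hp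
    rw [← MvPolynomial.algebraMap_eq, AlgHom.commutes, ← Algebra.smul_def,
      AddMonoidAlgebra.coeff_smul_apply, hg p hp, smul_zero]
  | add s s' hs hs' =>
    intro p hp
    rw [map_add, add_mul, AddMonoidAlgebra.coeff_add, Finsupp.add_apply, hs hg p hp, hs' hg p hp,
      add_zero]
  | mul_X s v hs =>
    rw [map_mul, mul_assoc]
    refine hs fun p hp => ?_
    rw [theta_X, add_mul, AddMonoidAlgebra.coeff_add, Finsupp.add_apply]
    have h_left : ((if v.1 ≤ x then AddMonoidAlgebra.single (dvec P n y x v.1, 0) (1 : K) else 0)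
        * g).coeff p = 0 := by
      split_ifs
      · exact key (dvec P n y x v.1, 0) le_rfl hg p hp
      · rw [zero_mul, AddMonoidAlgebra.coeff_zero, Finsupp.zero_apply]
    rw [h_left, zero_add]
    split_ifs with h
    · rw [zero_mul, AddMonoidAlgebra.coeff_zero, Finsupp.zero_apply]
    · exact key (0, Finsupp.single _ 1) (Finsupp.single_nonneg.2 zero_le_one) hg p hp

lemma coeff_eq_zero_of_mem_Ux {x : P} {g : Gx K P n y x} (hg : g ∈ Ux K P n y x) :
    ∀ p : EIdx P n y x, p.2 ≤ 0 → g.coeff p = 0 := by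
  induction hg using Submodule.span_induction with
  | mem g hg =>
    obtain ⟨q, ⟨w, hw⟩, rfl⟩ := hg
    intro p hp
    rw [AddMonoidAlgebra.coeff_single, Finsupp.single_apply_eq_zero]
    rintro rfl
    exact absurd (hp w) (not_le.2 hw)
  | zero => simp
  | add g g' _ _ hg hg' =>
    intro p hp
    rw [AddMonoidAlgebra.coeff_add, Finsupp.add_apply, hg p hp, hg' p hp, add_zero]
  | smul s g _ hg => exact coeff_theta_mul s hg

variable (K) in
/-- The coefficient of the basis monomial `t^a ⊗ 1` of `*E_x`. -/
def coefOne {x : P} (a : BelowIx P n y x →₀ ℤ) : ExMod K P n y x →ₗ[K] K :=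
  ((Ux K P n y x).restrictScalars K).liftQ
    ((Finsupp.lapply ((a, 0) : EIdx P n y x)).comp
      (AddMonoidAlgebra.coeffLinearEquiv K).toLinearMap)
    (fun _ hg => coeff_eq_zero_of_mem_Ux hg (a, 0) le_rfl) ∘ₗ
  (Submodule.Quotient.restrictScalarsEquiv K (Ux K P n y x)).symm.toLinearMap

lemma coefOne_mkMono {x : P} (a : BelowIx P n y x →₀ ℤ) (p : EIdx P n y x) :
    coefOne K a (mkMono K p) = if p = (a, 0) then 1 else 0 :=
  Finsupp.single_apply

lemma coefOne_shift {x : P} (a b : BelowIx P n y x →₀ ℤ) (e : ExMod K P n y x) :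
    coefOne K (a + b) (shift (a, 0) le_rfl e) = coefOne K b e := by
  have : (coefOne K (a + b)) ∘ₗ (shift (a, 0) le_rfl).restrictScalars K = coefOne K b := by
    refine LinearMap.ext_on_range (span_mkMono x) fun p => ?_
    rw [LinearMap.comp_apply, LinearMap.restrictScalars_apply, shift_mkMono, coefOne_mkMono,
      coefOne_mkMono]
    have : ((a + b, 0) : EIdx P n y x) = (a, 0) + (b, 0) := by simp
    simp only [this, add_right_inj]
  exact LinearMap.congr_fun this e

end Monomials

section Degrees

variable {K P n y}

lemma gdeg_apply {x : P} (p : EIdx P n y x) (i : Fin n) : gdeg P n y x p i =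
    (if h : y i ≤ x then p.1 ⟨i, h⟩ else 0) + ∑ w, p.2 w * (if y i ≤ w.1 then 1 else 0) := by
  rw [gdeg, Finsupp.sum_fintype _ _ (by simp)]

lemma gdeg_add {x : P} (p q : EIdx P n y x) :
    gdeg P n y x (p + q) = gdeg P n y x p + gdeg P n y x q := by
  funext i
  simp only [gdeg_apply, Pi.add_apply, Prod.fst_add, Prod.snd_add, Finsupp.add_apply, add_mul,
    Finset.sum_add_distrib]
  split_ifs <;> ring

variable (P n y) in
/-- `gdeg` as an additive homomorphism. -/
def gdegHom (x : P) : EIdx P n y x →+ (Fin n → ℤ) := AddMonoidHom.mk' (gdeg P n y x) gdeg_add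

variable (P n y) in
/-- The elements of `P*_{-x}` whose degree is supported on the atoms below `x`. -/
abbrev InnerIx (x : P) := {w : Pmx P n y x // ∀ i, y i ≤ w.1 → y i ≤ x}

/-- The exponent of the degree zero monomial `∏_{y_i ≤ w} t_i^{-1} ⊗ t_w`. -/
def unitExp {x : P} (w : InnerIx P n y x) : EIdx P n y x :=
  (-dvec P n y x w.1.1, Finsupp.single w.1 1)

lemma gdeg_unitExp {x : P} (w : InnerIx P n y x) : gdeg P n y x (unitExp w) = 0 := by
  funext i
  rw [gdeg_apply]
  simp only [unitExp, Finsupp.single_apply, ite_mul, one_mul, zero_mul, Finset.sum_ite_eq,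
    Finset.mem_univ, if_true, Pi.zero_apply, Finsupp.neg_apply, dvec,
    Finsupp.equivFunOnFinite_symm_apply_apply]
  have := w.2 i
  split_ifs <;> simp_all

/-- The exponent of the degree zero monomial `∏_w (∏_{y_i ≤ w} t_i^{-1} ⊗ t_w)^{c_w}`. -/
def seriesExp {x : P} : (InnerIx P n y x →₀ ℕ) →+ EIdx P n y x :=
  Finsupp.liftAddHom fun w => multiplesHom (EIdx P n y x) (unitExp w)

lemma seriesExp_single {x : P} (w : InnerIx P n y x) :
    seriesExp (Finsupp.single w 1) = unitExp w := by
  simp [seriesExp]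

lemma seriesExp_apply {x : P} (c : InnerIx P n y x →₀ ℕ) :
    seriesExp c = ∑ w, c w • unitExp w := by
  rw [seriesExp, Finsupp.liftAddHom_apply, Finsupp.sum_fintype _ _ (by simp)]
  simp

lemma gdeg_seriesExp {x : P} (c : InnerIx P n y x →₀ ℕ) : gdeg P n y x (seriesExp c) = 0 := by
  change gdegHom P n y x (seriesExp c) = 0
  rw [seriesExp_apply, map_sum]
  refine Finset.sum_eq_zero fun w _ => ?_
  rw [map_nsmul]
  change c w • gdeg P n y x (unitExp w) = 0
  rw [gdeg_unitExp, smul_zero]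

lemma seriesExp_snd_apply {x : P} (c : InnerIx P n y x →₀ ℕ) (v : Pmx P n y x) :
    (seriesExp c).2 v = if h : ∀ i, y i ≤ v.1 → y i ≤ x then (c ⟨v, h⟩ : ℤ) else 0 := by
  rw [seriesExp_apply, Prod.snd_sum, Finsupp.finsetSum_apply]
  simp only [Prod.smul_snd, Finsupp.smul_apply, unitExp, Finsupp.single_apply]
  split_ifs with h
  · rw [Finset.sum_eq_single ⟨v, h⟩]
    · simp
    · rintro w - hw
      rw [if_neg fun h' => hw (Subtype.ext h'), smul_zero]
    · simp
  · refine Finset.sum_eq_zero fun w _ => ?_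
    rw [if_neg, smul_zero]
    rintro rfl
    exact h w.2

lemma seriesExp_snd_nonneg {x : P} (c : InnerIx P n y x →₀ ℕ) : 0 ≤ (seriesExp c).2 := by
  intro v
  rw [seriesExp_snd_apply, Finsupp.zero_apply]
  split_ifs <;> simp

lemma seriesExp_injective {x : P} :
    Function.Injective (seriesExp : (InnerIx P n y x →₀ ℕ) → EIdx P n y x) := by
  intro c c' h
  ext w
  have := DFunLike.congr_fun (congr_arg Prod.snd h) w.1
  rw [seriesExp_snd_apply, seriesExp_snd_apply, dif_pos w.2, dif_pos w.2] at this
  exact_mod_cast this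

/-- Restriction of a degree to the atoms below `x`. -/
def resDeg (x : P) (d : Fin n → ℤ) : BelowIx P n y x →₀ ℤ :=
  Finsupp.equivFunOnFinite.symm fun i => d i.1

lemma sum_snd_nonpos {x : P} {p : EIdx P n y x} (hp : p.2 ≤ 0) (i : Fin n) (w : Pmx P n y x) :
    p.2 w * (if y i ≤ w.1 then 1 else 0) ≤ 0 :=
  mul_nonpos_of_nonpos_of_nonneg (hp w) (by split_ifs <;> simp)

/-- A monomial of nonnegative degree is, up to a monomial in the `t_i^{±1}`, the inverse of a
degree zero monomial. -/
lemma exists_add_seriesExp {x : P} {p : EIdx P n y x} (hp : p.2 ≤ 0)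
    (hd : 0 ≤ gdeg P n y x p) :
    ∃ c, p + seriesExp c = (resDeg x (gdeg P n y x p), 0) := by
  let c : InnerIx P n y x →₀ ℕ := Finsupp.equivFunOnFinite.symm fun w => (-p.2 w.1).toNat
  have hsnd : (p + seriesExp c).2 = 0 := by
    ext v
    rw [Prod.snd_add, Finsupp.add_apply, seriesExp_snd_apply]
    have hpv : p.2 v ≤ 0 := hp v
    split_ifs with h
    · change p.2 v + ((-p.2 v).toNat : ℤ) = 0
      omega
    · push Not at h
      obtain ⟨i, hi, hix⟩ := h
      have h1 := hd i
      rw [gdeg_apply, dif_neg hix, zero_add] at h1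
      have h2 := (Finset.sum_eq_zero_iff_of_nonpos fun w _ => sum_snd_nonpos hp i w).1
        (le_antisymm (Finset.sum_nonpos fun w _ => sum_snd_nonpos hp i w) h1) v (Finset.mem_univ v)
      simpa [hi] using h2
  refine ⟨c, Prod.ext ?_ hsnd⟩
  ext i
  have h := congr_fun (gdeg_add p (seriesExp c)) i.1
  rw [gdeg_seriesExp, add_zero, gdeg_apply, dif_pos i.2, hsnd] at h
  simpa [resDeg] using h

lemma gdeg_nonpos_of_not_le {x : P} {p : EIdx P n y x} (hp : p.2 ≤ 0) {i : Fin n} (hi : ¬ y i ≤ x) :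
    gdeg P n y x p i ≤ 0 := by
  rw [gdeg_apply, dif_neg hi, zero_add]
  exact Finset.sum_nonpos fun w _ => sum_snd_nonpos hp i w

lemma mem_ExGrade {x : P} (p : EIdx P n y x) :
    mkMono K p ∈ ExGrade K P n y x (gdeg P n y x p) :=
  Submodule.subset_span ⟨p, rfl, rfl⟩

lemma ExGrade_induction {x : P} {d : Fin n → ℤ} {motive : ExMod K P n y x → Prop}
    (zero : motive 0) (add : ∀ e f, motive e → motive f → motive (e + f))
    (smul : ∀ (a : K) e, motive e → motive (a • e))
    (mono : ∀ p : EIdx P n y x, p.2 ≤ 0 → gdeg P n y x p = d → motive (mkMono K p))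
    {e : ExMod K P n y x} (he : e ∈ ExGrade K P n y x d) : motive e := by
  induction he using Submodule.span_induction with
  | mem e he =>
    obtain ⟨p, hpd, rfl⟩ := he
    by_cases hp : p.2 ≤ 0
    · exact mono p hp hpd
    · change motive (mkMono K p)
      rwa [mkMono_eq_zero hp]
  | zero => exact zero
  | add e f _ _ he hf => exact add e f he hf
  | smul a e _ he => exact smul a e he

lemma shift_mem_ExGrade {x : P} {q : EIdx P n y x} (hq : 0 ≤ q.2) (hqd : gdeg P n y x q = 0)
    {d : Fin n → ℤ} {e : ExMod K P n y x} (he : e ∈ ExGrade K P n y x d) :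
    shift q hq e ∈ ExGrade K P n y x d := by
  refine ExGrade_induction (motive := fun e => shift q hq e ∈ ExGrade K P n y x d) ?_ ?_ ?_ ?_ he
  · simp
  · intro e f he hf
    rw [map_add]
    exact add_mem he hf
  · intro a e he
    rw [LinearMap.map_smul_of_tower]
    exact Submodule.smul_mem _ _ he
  · rintro p - rfl
    rw [shift_mkMono]
    simpa [gdeg_add, hqd] using mem_ExGrade (K := K) (q + p)

variable (K) in
/-- Multiplication by the degree zero monomial of exponent `seriesExp c`. -/
def seriesShift (x : P) (c : InnerIx P n y x →₀ ℕ) :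
    ExMod K P n y x →ₗ[FaceS K P] ExMod K P n y x :=
  shift (seriesExp c) (seriesExp_snd_nonneg c)

lemma seriesShift_zero {x : P} (e : ExMod K P n y x) : seriesShift K x 0 e = e := by
  obtain ⟨g, rfl⟩ := Submodule.Quotient.mk_surjective _ e
  rw [seriesShift, shift_mk, map_zero, ← AddMonoidAlgebra.one_def, one_mul]

lemma seriesShift_add {x : P} (c c' : InnerIx P n y x →₀ ℕ) (e : ExMod K P n y x) :
    seriesShift K x (c + c') e = seriesShift K x c (seriesShift K x c' e) := by
  obtain ⟨g, rfl⟩ := Submodule.Quotient.mk_surjective _ e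
  simp only [seriesShift, shift_mk]
  rw [← mul_assoc, AddMonoidAlgebra.single_mul_single, mul_one, map_add]

lemma seriesShift_mkMono {x : P} (c : InnerIx P n y x →₀ ℕ) (p : EIdx P n y x) :
    seriesShift K x c (mkMono K p) = mkMono K (seriesExp c + p) :=
  shift_mkMono _ _ _

lemma seriesShift_finite {x : P} (e : ExMod K P n y x) :
    {c | seriesShift K x c e ≠ 0}.Finite := by
  have he : e ∈ Submodule.span K (Set.range (mkMono K : EIdx P n y x → _)) := by
    rw [span_mkMono]
    trivial
  induction he using Submodule.span_induction with
  | mem e he =>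
    obtain ⟨p, rfl⟩ := he
    let b : InnerIx P n y x →₀ ℕ := Finsupp.equivFunOnFinite.symm fun w => (-p.2 w.1).toNat
    refine (Set.finite_Icc 0 b).subset fun c hc => ⟨zero_le, fun w => ?_⟩
    rw [Set.mem_ofPred_eq, seriesShift_mkMono] at hc
    have h : (seriesExp c + p).2 w.1 ≤ 0 := by
      by_contra h
      exact hc (mkMono_eq_zero fun h' => h (h' w.1))
    rw [Prod.snd_add, Finsupp.add_apply, seriesExp_snd_apply, dif_pos w.2] at h
    change c w ≤ (-p.2 w.1).toNat
    have : c ⟨w.1, w.2⟩ = c w := rfl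
    omega
  | zero => simp
  | add e f _ _ he hf =>
    refine (he.union hf).subset fun c hc => ?_
    by_contra h
    simp_all
  | smul a e _ he =>
    refine he.subset fun c hc h => hc ?_
    rw [LinearMap.map_smul_of_tower, h, smul_zero]

lemma exp_eq_iff {x : P} {p : EIdx P n y x} {a : BelowIx P n y x →₀ ℤ}
    {c : InnerIx P n y x →₀ ℕ} (hc : p + seriesExp c = (a, 0)) (c' : InnerIx P n y x →₀ ℕ) :
    seriesExp c' + p = (a, 0) ↔ c' = c := by
  rw [← hc, add_comm p, add_left_inj, seriesExp_injective.eq_iff]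

/-- A homogeneous element of nonnegative degree is determined by the coefficients of `t^a ⊗ 1` in
its images under the degree zero monomials. -/
lemma eq_finsum_coefOne {x : P} {d : Fin n → ℤ} (hd : 0 ≤ d) {e : ExMod K P n y x}
    (he : e ∈ ExGrade K P n y x d) :
    e = ∑ᶠ c, coefOne K (resDeg x d) (seriesShift K x c e) •
      mkMono K ((resDeg x d, 0) - seriesExp c) := by
  have hfin (e : ExMod K P n y x) : Function.HasFiniteSupport fun c =>
      coefOne K (resDeg x d) (seriesShift K x c e) •
        mkMono K ((resDeg x d, 0) - seriesExp c) :=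
    (seriesShift_finite e).subset fun c hc h => hc (by simp [h])
  refine ExGrade_induction (motive := fun e => e = ∑ᶠ c, coefOne K (resDeg x d)
    (seriesShift K x c e) • mkMono K ((resDeg x d, 0) - seriesExp c)) ?_ ?_ ?_ ?_ he
  · simp
  · intro e f he hf
    simp only [map_add, add_smul]
    rw [finsum_add_distrib (hfin e) (hfin f), ← he, ← hf]
  · intro a e he
    simp only [LinearMap.map_smul_of_tower, map_smul, smul_assoc]
    rw [← smul_finsum' a (hfin e), ← he]
  · rintro p hp rfl
    obtain ⟨c, hc⟩ := exists_add_seriesExp hp hd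
    simp only [seriesShift_mkMono, coefOne_mkMono, exp_eq_iff hc]
    rw [finsum_eq_single _ c fun c' hc' => by rw [if_neg hc', zero_smul], if_pos rfl, one_smul,
      ← hc, add_sub_cancel_right]

lemma exists_eq_mIdx {x : P} {p : EIdx P n y x} (hp : p.2 ≤ 0) :
    ∃ b, p = mIdx P n y x p.1 b ∧ (p.2 ≠ 0 → b ≠ 0) := by
  refine ⟨Finsupp.equivFunOnFinite.symm fun w => (-p.2 w).toNat, ?_, ?_⟩
  · refine Prod.ext rfl ?_
    ext w
    have : p.2 w ≤ 0 := hp w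
    simp only [mIdx, Finsupp.neg_apply, Finsupp.mapRange_apply,
      Finsupp.equivFunOnFinite_symm_apply_apply]
    omega
  · intro h0 h
    refine h0 ?_
    ext w
    have h1 : p.2 w ≤ 0 := hp w
    have h2 : (-p.2 w).toNat = 0 := DFunLike.congr_fun h w
    rw [Finsupp.zero_apply]
    omega

lemma mkMono_mem_cleanL {x : P} {p : EIdx P n y x} (hp : p.2 ≤ 0) (hp0 : p.2 ≠ 0)
    (hd : 0 ≤ gdeg P n y x p) : mkMono K p ∈ cleanL K P n y x := by
  obtain ⟨b, hb, hb0⟩ := exists_eq_mIdx hp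
  refine Submodule.subset_span ⟨p.1, b, hb0 hp0, ?_, ?_⟩
  · rwa [← hb]
  · rw [emono, ← hb, mkMono]

lemma mem_cleanL_of_coefOne_eq_zero {x : P} {d : Fin n → ℤ} (hd : 0 ≤ d) {e : ExMod K P n y x}
    (he : e ∈ ExGrade K P n y x d) (h0 : coefOne K (resDeg x d) e = 0) :
    e ∈ cleanL K P n y x := by
  rw [eq_finsum_coefOne hd he]
  refine finsum_induction (· ∈ cleanL K P n y x) (zero_mem _) (fun _ _ => add_mem) fun c => ?_
  by_cases hc : c = 0
  · subst hc
    rw [seriesShift_zero, h0, zero_smul]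
    exact zero_mem _
  · refine Submodule.smul_mem _ _ (mkMono_mem_cleanL ?_ ?_ ?_)
    · rw [Prod.snd_sub, sub_nonpos]
      exact seriesExp_snd_nonneg c
    · rw [Prod.snd_sub, zero_sub, neg_ne_zero]
      refine fun h => hc ?_
      ext w
      have := DFunLike.congr_fun h w.1
      rw [seriesExp_snd_apply, dif_pos w.2, Finsupp.zero_apply] at this
      rw [Finsupp.zero_apply]
      exact_mod_cast this
    · change 0 ≤ gdegHom P n y x _
      rw [map_sub]
      change 0 ≤ gdeg P n y x _ - gdeg P n y x _
      rw [gdeg_seriesExp, sub_zero]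
      intro i
      rw [gdeg_apply]
      simp only [Finsupp.zero_apply, zero_mul, Finset.sum_const_zero, add_zero, Pi.zero_apply]
      split_ifs
      · exact hd i
      · exact le_rfl

lemma eq_zero_of_not_supported {x : P} {d : Fin n → ℤ} {i : Fin n} (hi : ¬ y i ≤ x) (hdi : 0 < d i)
    {e : ExMod K P n y x} (he : e ∈ ExGrade K P n y x d) : e = 0 := by
  refine ExGrade_induction (motive := fun e => e = 0) rfl ?_ ?_ ?_ he
  · rintro _ _ rfl rfl
    exact add_zero 0
  · rintro a _ rfl
    exact smul_zero a
  · rintro p hp rfl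
    exact absurd hdi (not_lt.2 (gdeg_nonpos_of_not_le hp hi))

end Degrees

section Homomorphisms

variable {K P n y}

lemma le_iff_eq_of_atomEnum (hy : AtomEnum P n y) {i j : Fin n} : y i ≤ y j ↔ i = j := by
  refine ⟨fun h => hy.1 ?_, fun h => h ▸ le_rfl⟩
  have hi : IsAtom (y i) := (hy.2 _).2 ⟨i, rfl⟩
  have hj : IsAtom (y j) := (hy.2 _).2 ⟨j, rfl⟩
  exact (hj.le_iff.1 h).resolve_left hi.1

lemma theta_tvar_atom (hy : AtomEnum P n y) {x : P} {i : Fin n} (hi : y i ≤ x) :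
    theta K P n y x (tvar K P (y i)) = AddMonoidAlgebra.single (dvec P n y x (y i), 0) 1 := by
  have h0 : y i ≠ ⊥ := ((hy.2 _).2 ⟨i, rfl⟩).1
  rw [tvar, dif_neg h0, theta_X, if_pos hi, dif_pos ⟨i, hi, rfl⟩, add_zero]

lemma theta_prod_atoms (hy : AtomEnum P n y) {x : P} {d : Fin n → ℕ}
    (hd : ∀ i, d i ≠ 0 → y i ≤ x) :
    theta K P n y x (∏ i, tvar K P (y i) ^ d i) =
      AddMonoidAlgebra.single (resDeg x fun i => (d i : ℤ), 0) 1 := by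
  have h_factor (i : Fin n) : theta K P n y x (tvar K P (y i) ^ d i) =
      AddMonoidAlgebra.single (d i • ((dvec P n y x (y i), 0) : EIdx P n y x)) 1 := by
    by_cases h : d i = 0
    · rw [h, pow_zero, map_one, zero_smul, AddMonoidAlgebra.one_def]
    · rw [map_pow, theta_tvar_atom hy (hd i h), AddMonoidAlgebra.single_pow, one_pow]
  rw [map_prod]
  simp only [h_factor]
  rw [AddMonoidAlgebra.prod_single, Finset.prod_const_one]
  congr 1
  refine Prod.ext ?_ ?_
  · ext j
    simp [Prod.fst_sum, resDeg, dvec, le_iff_eq_of_atomEnum hy]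
  · simp [Prod.snd_sum]

lemma le_of_atoms_le (hP : IsSimplicialPoset P) (hy : AtomEnum P n y) {x z w : P} (hzx : z ≤ x)
    (hwx : w ≤ x) (h : ∀ i, y i ≤ w → y i ≤ z) : w ≤ z := by
  obtain ⟨m, ⟨f⟩⟩ := hP x
  have key : f ⟨w, hwx⟩ ≤ f ⟨z, hzx⟩ := by
    intro k hk
    let u : Set.Iic x := f.symm {k}
    have hu : IsAtom u := by
      rw [OrderIso.isAtom_iff f.symm]
      exact Finset.isAtom_singleton k
    have hu' : IsAtom u.1 := by
      refine ⟨fun h => hu.1 (Subtype.ext h), fun b hb => ?_⟩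
      have := hu.2 ⟨b, hb.le.trans u.2⟩ hb
      exact congr_arg Subtype.val this
    obtain ⟨i, hi⟩ := (hy.2 _).1 hu'
    have huw : u ≤ ⟨w, hwx⟩ := by
      rw [f.symm_apply_le]
      simpa using hk
    have huz : u ≤ ⟨z, hzx⟩ := by
      change u.1 ≤ z
      rw [← hi]
      exact h i (hi ▸ huw)
    rw [f.symm_apply_le] at huz
    simpa using huz
  exact f.le_iff_le.1 key

variable {x z : P}

/-- An element of `S` acting as `1 ⊗ t_w` on both `*E_x` and `*E_z`. -/
lemma exists_smul_eq_shift (hP : IsSimplicialPoset P) (hy : AtomEnum P n y) (hzx : z ≤ x)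
    (w : InnerIx P n y z) : ∃ (s : FaceS K P) (w' : Pmx P n y x),
      theta K P n y z s = AddMonoidAlgebra.single (0, Finsupp.single w.1 1) 1 ∧
      theta K P n y x s = AddMonoidAlgebra.single (0, Finsupp.single w' 1) 1 := by
  have hatom : ¬ ∃ i, y i = w.1.1 := by
    rintro ⟨i, hi⟩
    exact w.1.2.2 ⟨i, w.2 i hi.le, hi⟩
  have hatom' (v : P) : ¬ ∃ i, y i ≤ v ∧ y i = w.1.1 := fun h => hatom (h.imp fun _ => And.right)
  have hX (v : P) : theta K P n y v (X ⟨w.1.1, w.1.2.1⟩) =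
      (if w.1.1 ≤ v then AddMonoidAlgebra.single (dvec P n y v w.1.1, 0) 1 else 0) +
      AddMonoidAlgebra.single (0, Finsupp.single
        (⟨w.1.1, w.1.2.1, hatom' v⟩ : Pmx P n y v) 1) 1 := by
    rw [theta_X, dif_neg (hatom' v)]
  have hprod (v : P) (hv : z ≤ v) :
      theta K P n y v (∏ i, tvar K P (y i) ^ (if y i ≤ w.1.1 then 1 else 0)) =
        AddMonoidAlgebra.single (dvec P n y v w.1.1, 0) 1 := by
    rw [theta_prod_atoms hy fun i hi => (w.2 i (by simpa using hi)).trans hv]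
    congr 2
    ext j
    simp [resDeg, dvec]
  by_cases hwx : w.1.1 ≤ x
  · have hwz := le_of_atoms_le hP hy hzx hwx w.2
    refine ⟨X ⟨w.1.1, w.1.2.1⟩ - ∏ i, tvar K P (y i) ^ (if y i ≤ w.1.1 then 1 else 0),
      ⟨w.1.1, w.1.2.1, hatom' x⟩, ?_, ?_⟩
    · rw [map_sub, hX, hprod z le_rfl, if_pos hwz, add_sub_cancel_left]
    · rw [map_sub, hX, hprod x hzx, if_pos hwx, add_sub_cancel_left]
  · refine ⟨X ⟨w.1.1, w.1.2.1⟩, ⟨w.1.1, w.1.2.1, hatom' x⟩, ?_, ?_⟩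
    · rw [hX, if_neg fun h => hwx (h.trans hzx), zero_add]
    · rw [hX, if_neg hwx, zero_add]

lemma onex_eq_mkMono : onex K P n y x = mkMono K 0 := by
  have : mIdx P n y x 0 0 = 0 := by simp [mIdx]
  rw [onex, emono, this, mkMono]

variable (φ : ExMod K P n y x →ₗ[FaceS K P] ExMod K P n y z)

lemma seriesShift_apply_onex (hP : IsSimplicialPoset P) (hy : AtomEnum P n y) (hzx : z ≤ x)
    {c : InnerIx P n y z →₀ ℕ} (hc : c ≠ 0) : seriesShift K z c (φ (mkMono K 0)) = 0 := by
  obtain ⟨w, hw⟩ : ∃ w, c w ≠ 0 := by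
    by_contra! h
    exact hc (Finsupp.ext h)
  obtain ⟨c', rfl⟩ : ∃ c', c = c' + Finsupp.single w 1 :=
    ⟨c - Finsupp.single w 1, (tsub_add_cancel_of_le
      (Finsupp.single_le_iff.2 (Nat.one_le_iff_ne_zero.2 hw))).symm⟩
  rw [seriesShift_add]
  obtain ⟨s, w', hsz, hsx⟩ := exists_smul_eq_shift (K := K) hP hy hzx w
  have h1 : shift (0, Finsupp.single w.1 1) (Finsupp.single_nonneg.2 zero_le_one)
      (φ (mkMono K 0)) = 0 := by
    rw [← smul_eq_shift (s := s) _ hsz, ← map_smul,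
      smul_eq_shift (Finsupp.single_nonneg.2 zero_le_one) hsx, shift_mkMono, mkMono_eq_zero,
      map_zero]
    intro h
    have := h w'
    simp at this
  have h2 : seriesShift K z (Finsupp.single w 1) (φ (mkMono K 0)) =
      shift (-dvec P n y z w.1.1, 0) le_rfl (shift (0, Finsupp.single w.1 1)
        (Finsupp.single_nonneg.2 zero_le_one) (φ (mkMono K 0))) := by
    obtain ⟨g, hg⟩ := Submodule.Quotient.mk_surjective _ (φ (mkMono K 0))
    rw [← hg, seriesShift]
    simp only [shift_mk]
    rw [← mul_assoc, AddMonoidAlgebra.single_mul_single, mul_one, seriesExp_single]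
    simp [unitExp]
  rw [h2, h1, map_zero, map_zero]

lemma coefOne_apply_onex_ne_zero (hP : IsSimplicialPoset P) (hy : AtomEnum P n y) (hzx : z ≤ x)
    (hdeg : DegZero K P n y x z φ) (hne : φ (onex K P n y x) ≠ 0) :
    coefOne K 0 (φ (mkMono K 0)) ≠ 0 := by
  rw [onex_eq_mkMono] at hne
  intro h
  have hres : resDeg (y := y) z (0 : Fin n → ℤ) = 0 := by ext; rfl
  have h_deg : gdeg P n y x 0 = 0 := (gdegHom P n y x).map_zero
  have he : φ (mkMono K 0) ∈ ExGrade K P n y z 0 :=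
    hdeg 0 _ (h_deg ▸ mem_ExGrade 0)
  refine hne ((eq_finsum_coefOne le_rfl he).trans ?_)
  refine (finsum_congr fun c => ?_).trans finsum_zero
  by_cases hc : c = 0
  · rw [hc, seriesShift_zero, hres, h, zero_smul]
  · rw [seriesShift_apply_onex φ hP hy hzx hc, map_zero, zero_smul]

/-- The coefficients of `t^a ⊗ 1` in `φ e` are those of a power series in the degree zero monomials
applied to `e`. -/
lemma coefOne_apply_eq (hy : AtomEnum P n y) (hzx : z ≤ x) {d : Fin n → ℤ} (hd : 0 ≤ d)
    (hdz : ∀ i, d i ≠ 0 → y i ≤ z) {e : ExMod K P n y x} (he : e ∈ ExGrade K P n y x d) (r : K) :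
    coefOne K (resDeg x d) (seriesEnd (seriesShift K x) seriesShift_finite
      (fun c => r * coefOne K 0 (φ (mkMono K (-seriesExp c)))) e) =
      r * coefOne K (resDeg z d) (φ e) := by
  lift d to Fin n → ℕ using hd
  refine ExGrade_induction (motive := fun e => coefOne K (resDeg x _) (seriesEnd (seriesShift K x)
    seriesShift_finite (fun c => r * coefOne K 0 (φ (mkMono K (-seriesExp c)))) e) =
      r * coefOne K (resDeg z _) (φ e)) ?_ ?_ ?_ ?_ he
  · simp
  · intro e f he hf
    rw [map_add, map_add, he, hf, map_add, map_add, mul_add]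
  · intro a e he
    rw [LinearMap.map_smul_of_tower, LinearMap.map_smul_of_tower φ, map_smul, map_smul, he]
    simp only [smul_eq_mul]
    ring
  · rintro p hp hpd
    obtain ⟨c, hc⟩ := exists_add_seriesExp hp (by rw [hpd]; exact fun i => by simp)
    rw [hpd] at hc
    rw [seriesEnd_apply, map_finsum _ (hasFiniteSupport_smul (seriesShift_finite _) _)]
    simp only [map_smul, seriesShift_mkMono, coefOne_mkMono, exp_eq_iff hc]
    rw [finsum_eq_single _ c fun c' hc' => by rw [if_neg hc', smul_zero], if_pos rfl, smul_eq_mul,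
      mul_one]
    congr 1
    have hmono : mkMono K p = (∏ i, tvar K P (y i) ^ d i) • mkMono K (-seriesExp c) := by
      rw [smul_eq_shift le_rfl (theta_prod_atoms hy fun i hi => (hdz i (by simpa using hi)).trans hzx),
        shift_mkMono]
      congr 1
      rw [← sub_eq_add_neg, eq_sub_iff_add_eq]
      exact hc
    rw [hmono, map_smul, smul_eq_shift le_rfl (theta_prod_atoms hy fun i hi =>
      hdz i (by simpa using hi)), ← coefOne_shift (resDeg z _) 0, add_zero]

end Homomorphisms

/-- Theorem 3.12: for `x ≥ z` and a degree preserving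
`φ : *E_x → *E_z` with `φ(1_x) ≠ 0`, there is a `ℤⁿ`-graded `S`-module
automorphism `σ` of `*E_x` such that `φ ∘ σ` is clean. -/
theorem statement17
    (hP : IsSimplicialPoset P) (hy : AtomEnum P n y)
    (x z : P) (hzx : z ≤ x)
    (φ : ExMod K P n y x →ₗ[FaceS K P] ExMod K P n y z)
    (hdeg : DegZero K P n y x z φ)
    (hne : φ (onex K P n y x) ≠ 0) :
    ∃ σ : ExMod K P n y x ≃ₗ[FaceS K P] ExMod K P n y x,
      (∀ aa, ∀ e ∈ ExGrade K P n y x aa, σ e ∈ ExGrade K P n y x aa) ∧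
      (∀ aa, ∀ e ∈ ExGrade K P n y x aa, σ.symm e ∈ ExGrade K P n y x aa) ∧
      IsClean K P n y x z (φ.comp σ.toLinearMap) := by
  set r := coefOne K 0 (φ (mkMono K 0)) with hr_def
  have hr : r ≠ 0 := coefOne_apply_onex_ne_zero φ hP hy hzx hdeg hne
  obtain ⟨σ, hσ, hmem⟩ := exists_inverse_seriesEnd (U := seriesShift K x) seriesShift_finite
    (lam := fun c => r⁻¹ * coefOne K 0 (φ (mkMono K (-seriesExp c)))) seriesShift_zero
    seriesShift_add (by rw [map_zero, neg_zero]; exact inv_mul_cancel₀ hr)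
  have hshift (aa : Fin n → ℤ) (c) : ∀ e ∈ ExGrade K P n y x aa,
      seriesShift K x c e ∈ ExGrade K P n y x aa := fun e he =>
    shift_mem_ExGrade (seriesExp_snd_nonneg c) (gdeg_seriesExp c) he
  have hσdeg (aa : Fin n → ℤ) (e) (he : e ∈ ExGrade K P n y x aa) :
      σ e ∈ ExGrade K P n y x aa := hmem _ (hshift aa) e he
  refine ⟨σ, hσdeg, fun aa e he => ?_, fun aa e he => hdeg aa _ (hσdeg aa e he), fun e he => ?_⟩
  · rw [hσ]
    exact seriesEnd_mem _ (hshift aa) he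
  induction he using Submodule.span_induction with
  | zero => rw [map_zero]; exact zero_mem _
  | add e f _ _ he hf => rw [map_add]; exact add_mem he hf
  | smul a e _ he =>
    rw [LinearMap.map_smul_of_tower]
    exact Submodule.smul_mem _ _ he
  | mem e he =>
    obtain ⟨a, b, hb, hd, rfl⟩ := he
    set d := gdeg P n y x (mIdx P n y x a b)
    have h_grade := hσdeg d _ (mem_ExGrade (K := K) (mIdx P n y x a b))
    have h_image := hdeg d _ h_grade
    change φ (σ (mkMono K (mIdx P n y x a b))) ∈ _
    by_cases hdz : ∀ i, d i ≠ 0 → y i ≤ z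
    · refine mem_cleanL_of_coefOne_eq_zero hd h_image ?_
      have key := coefOne_apply_eq φ hy hzx hd hdz h_grade r⁻¹
      rw [← hσ, σ.symm_apply_apply, coefOne_mkMono, if_neg] at key
      · exact (mul_eq_zero.1 key.symm).resolve_left (inv_ne_zero hr)
      · intro h
        refine hb ?_
        ext w
        have := DFunLike.congr_fun (congr_arg Prod.snd h) w
        simpa [mIdx] using this
    · push Not at hdz
      obtain ⟨i, hi, hiz⟩ := hdz
      rw [eq_zero_of_not_supported hiz ((hd i).lt_of_ne' hi) h_image]
      exact zero_mem _

end
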